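/- arXiv:2312.14351 — 3 statements merged into one kernel-verified Lean document; each statement's English description precedes it below -/
import Mathlib

section
/- Let (d_n) be the sequence defined by d_0 = d_1 = 1 and, for n ≥ 2, d_n = Σ_{i=1}^{n} ⌈i/2⌉ · d_{n−i}. Then for every integer n ≥ 1, the number of permutations π in S_n such that π avoids the pattern 312 and π² avoids the pattern 321 is at least d_n. -/
/-- A permutation `π` of `Fin n` contains the pattern `τ` (a permutation of `Fin m`)
if there is a strictly increasing choice of `m` indices on which `π` is
order-isomorphic to `τ`. -/
def PermContains {n m : ℕ} (π : Equiv.Perm (Fin n)) (τ : Equiv.Perm (Fin m)) : Prop :=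
  ∃ f : Fin m → Fin n, StrictMono f ∧ ∀ i j : Fin m, τ i < τ j ↔ π (f i) < π (f j)

/-- `π` avoids the pattern `τ`. -/
def PermAvoids {n m : ℕ} (π : Equiv.Perm (Fin n)) (τ : Equiv.Perm (Fin m)) : Prop :=
  ¬ PermContains π τ

/-- The pattern 123 (one-line notation), as a permutation of `Fin 3`. -/
def p123 : Equiv.Perm (Fin 3) := ⟨![0,1,2], ![0,1,2], by decide, by decide⟩
/-- The pattern 132. -/
def p132 : Equiv.Perm (Fin 3) := ⟨![0,2,1], ![0,2,1], by decide, by decide⟩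
/-- The pattern 213. -/
def p213 : Equiv.Perm (Fin 3) := ⟨![1,0,2], ![1,0,2], by decide, by decide⟩
/-- The pattern 231. -/
def p231 : Equiv.Perm (Fin 3) := ⟨![1,2,0], ![2,0,1], by decide, by decide⟩
/-- The pattern 312. -/
def p312 : Equiv.Perm (Fin 3) := ⟨![2,0,1], ![1,2,0], by decide, by decide⟩
/-- The pattern 321. -/
def p321 : Equiv.Perm (Fin 3) := ⟨![2,1,0], ![2,1,0], by decide, by decide⟩

/-- `f` restricts to a permutation of `{0, …, n - 1}` that avoids 312 and whose square
avoids 321, and `f` fixes every other number. -/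
structure GoodOn (n : ℕ) (f : ℕ → ℕ) : Prop where
  map_lt : ∀ x < n, f x < n
  inj : ∀ x < n, ∀ y < n, f x = f y → x = y
  fix : ∀ x, n ≤ x → f x = x
  avoid312 : ∀ a b c, a < b → b < c → c < n → f b < f c → f c < f a → False
  sq_avoid321 : ∀ a b c, a < b → b < c → c < n →
    f (f c) < f (f b) → f (f b) < f (f a) → False

/-- The permutation of `{0, …, n - 1}` induced by a good function. -/
noncomputable def GoodOn.toPerm {n : ℕ} {f : ℕ → ℕ} (h : GoodOn n f) : Equiv.Perm (Fin n) :=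
  Equiv.ofBijective (fun x => ⟨f x, h.map_lt x x.2⟩) <| Finite.injective_iff_bijective.1 <| by
    intro x y hxy
    exact Fin.ext (h.inj x x.2 y y.2 (congrArg Fin.val hxy))

theorem GoodOn.toPerm_val {n : ℕ} {f : ℕ → ℕ} (h : GoodOn n f) (x : Fin n) :
    (h.toPerm x : ℕ) = f x := rfl

theorem GoodOn.toPerm_avoids {n : ℕ} {f : ℕ → ℕ} (h : GoodOn n f) :
    PermAvoids h.toPerm p312 ∧ PermAvoids (h.toPerm ^ 2) p321 := by
  constructor
  · rintro ⟨e, he, hp⟩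
    have h1 := (hp 1 2).1 (by decide)
    have h2 := (hp 2 0).1 (by decide)
    have e1 : e 0 < e 1 := he (by decide)
    have e2 : e 1 < e 2 := he (by decide)
    exact h.avoid312 _ _ _ e1 e2 (e 2).2 h1 h2
  · rintro ⟨e, he, hp⟩
    have h1 := (hp 2 1).1 (by decide)
    have h2 := (hp 1 0).1 (by decide)
    have e1 : e 0 < e 1 := he (by decide)
    have e2 : e 1 < e 2 := he (by decide)
    rw [pow_two] at h1 h2
    exact h.sq_avoid321 _ _ _ e1 e2 (e 2).2 h1 h2

/-- Good functions, viewed as permutations with the required avoidance properties. -/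
noncomputable def goodToPerm (n : ℕ) (f : {f : ℕ → ℕ // GoodOn n f}) :
    {π : Equiv.Perm (Fin n) // PermAvoids π p312 ∧ PermAvoids (π ^ 2) p321} :=
  ⟨f.2.toPerm, f.2.toPerm_avoids⟩

theorem goodToPerm_injective (n : ℕ) : Function.Injective (goodToPerm n) := by
  intro f g hfg
  have hp : f.2.toPerm = g.2.toPerm := congrArg Subtype.val hfg
  apply Subtype.ext
  funext x
  by_cases hx : x < n
  · have := congrArg (fun π : Equiv.Perm (Fin n) => (π ⟨x, hx⟩ : ℕ)) hp
    simpa only [GoodOn.toPerm_val] using this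
  · rw [f.2.fix x (by omega), g.2.fix x (by omega)]

theorem finite_goodOn (n : ℕ) : {f : ℕ → ℕ | GoodOn n f}.Finite :=
  Set.finite_coe_iff.1 (Finite.of_injective _ (goodToPerm_injective n))

/-- The finite set of good functions. -/
noncomputable def goodFinset (n : ℕ) : Finset (ℕ → ℕ) := (finite_goodOn n).toFinset

theorem mem_goodFinset {n : ℕ} {f : ℕ → ℕ} : f ∈ goodFinset n ↔ GoodOn n f := by
  simp [goodFinset]

theorem card_goodFinset_le (n : ℕ) :
    (goodFinset n).card ≤ Nat.card {π : Equiv.Perm (Fin n) //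
      PermAvoids π p312 ∧ PermAvoids (π ^ 2) p321} := by
  have h := Nat.card_le_card_of_injective _ (goodToPerm_injective n)
  rw [goodFinset, ← Set.ncard_eq_toFinset_card _ (finite_goodOn n)]
  exact h

/-- The direct sum of a permutation `g` of `{0, …, m - 1}` and `f`. -/
def natDirectSum (m : ℕ) (g f : ℕ → ℕ) (x : ℕ) : ℕ :=
  if x < m then g x else f (x - m) + m

theorem natDirectSum_of_lt {m x : ℕ} (g f : ℕ → ℕ) (h : x < m) :
    natDirectSum m g f x = g x := if_pos h

theorem natDirectSum_add (m : ℕ) (g f : ℕ → ℕ) (x : ℕ) :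
    natDirectSum m g f (m + x) = f x + m := by
  simp [natDirectSum]

theorem GoodOn.natDirectSum {m n : ℕ} {g f : ℕ → ℕ} (hg : GoodOn m g) (hf : GoodOn n f) :
    GoodOn (m + n) (natDirectSum m g f) := by
  have cases_lt : ∀ x, x < m ∨ ∃ y, x = m + y := fun x => by
    rcases Nat.lt_or_ge x m with h | h
    · exact Or.inl h
    · exact Or.inr ⟨x - m, by omega⟩
  have sq_lt : ∀ x < m, _root_.natDirectSum m g f (_root_.natDirectSum m g f x) = g (g x) := by
    intro x hx
    rw [natDirectSum_of_lt _ _ hx, natDirectSum_of_lt _ _ (hg.map_lt x hx)]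
  have sq_add : ∀ x, _root_.natDirectSum m g f (_root_.natDirectSum m g f (m + x))
      = f (f x) + m := by
    intro x
    rw [natDirectSum_add, add_comm, natDirectSum_add]
  have sq_map : ∀ x < m, g (g x) < m := fun x hx => hg.map_lt _ (hg.map_lt x hx)
  refine ⟨?_, ?_, ?_, ?_, ?_⟩
  · intro x hx
    rcases cases_lt x with h | ⟨x, rfl⟩
    · rw [natDirectSum_of_lt _ _ h]
      exact lt_of_lt_of_le (hg.map_lt x h) (Nat.le_add_right _ _)
    · rw [natDirectSum_add]
      have := hf.map_lt x (by omega)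
      omega
  · intro x hx y hy hxy
    rcases cases_lt x with h | ⟨x, rfl⟩ <;> rcases cases_lt y with h' | ⟨y, rfl⟩ <;>
      simp only [natDirectSum_add, natDirectSum_of_lt, *] at hxy
    · exact hg.inj x h y h' hxy
    · have := hg.map_lt x h
      omega
    · have := hg.map_lt y h'
      omega
    · have := hf.inj x (by omega) y (by omega) (by omega)
      omega
  · intro x hx
    obtain ⟨x, rfl⟩ : ∃ y, x = m + y := ⟨x - m, by omega⟩
    rw [natDirectSum_add, hf.fix x (by omega), add_comm]
  · intro a b c hab hbc hc h1 h2
    rcases cases_lt a with ha | ⟨a, rfl⟩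
    · rw [natDirectSum_of_lt g f ha] at h2
      rcases cases_lt c with hc' | ⟨c, rfl⟩
      · rw [natDirectSum_of_lt g f hc'] at h1 h2
        rw [natDirectSum_of_lt g f (hbc.trans hc')] at h1
        exact hg.avoid312 a b c hab hbc hc' h1 h2
      · rw [natDirectSum_add] at h2
        have := hg.map_lt a ha
        omega
    · obtain ⟨b, rfl⟩ : ∃ y, b = m + y := ⟨b - m, by omega⟩
      obtain ⟨c, rfl⟩ : ∃ y, c = m + y := ⟨c - m, by omega⟩
      simp only [natDirectSum_add] at h1 h2
      exact hf.avoid312 a b c (by omega) (by omega) (by omega) (by omega) (by omega)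
  · intro a b c hab hbc hc h1 h2
    rcases cases_lt a with ha | ⟨a, rfl⟩
    · rw [sq_lt a ha] at h2
      have := sq_map a ha
      rcases cases_lt b with hb | ⟨b, rfl⟩
      · rw [sq_lt b hb] at h1 h2
        have := sq_map b hb
        rcases cases_lt c with hc' | ⟨c, rfl⟩
        · rw [sq_lt c hc'] at h1
          exact hg.sq_avoid321 a b c hab hbc hc' h1 h2
        · rw [sq_add] at h1
          omega
      · rw [sq_add] at h2
        omega
    · obtain ⟨b, rfl⟩ : ∃ y, b = m + y := ⟨b - m, by omega⟩
      obtain ⟨c, rfl⟩ : ∃ y, c = m + y := ⟨c - m, by omega⟩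
      rw [sq_add] at h1 h2
      rw [sq_add] at h1 h2
      exact hf.sq_avoid321 a b c (by omega) (by omega) (by omega) (by omega) (by omega)

/-- The permutation of `{0, …, n - 1}` whose one-line notation is the decreasing word on
`{0, …, n - 2}` with the letter `n - 1` inserted at position `k`. -/
def decInsert (n k x : ℕ) : ℕ :=
  if n ≤ x then x else if x < k then n - 2 - x else if x = k then n - 1 else n - 1 - x

theorem decInsert_last {n k : ℕ} (hn : 1 ≤ n) (hk : k < (n + 1) / 2) :
    decInsert n k (n - 1) = 0 := by
  unfold decInsert
  split_ifs <;> omega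

theorem decInsert_self {n k : ℕ} (hk : k < n) : decInsert n k k = n - 1 := by
  simp [decInsert, hk]

theorem goodOn_decInsert {n k : ℕ} (hk : k < (n + 1) / 2) : GoodOn n (decInsert n k) := by
  have sq : ∀ x < n, decInsert n k (decInsert n k x) =
      if x = k then 0 else if x = n - 1 - k then n - 1 else
      if x + 1 = k ∧ 2 * k + 1 = n then n - 1 else
      if x < k then x + 1 else if x + k + 1 ≤ n then x else x - 1 := by
    intro x hx
    unfold decInsert
    split_ifs <;> omega
  have sq_lt : ∀ x < n, decInsert n k (decInsert n k x) < n := by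
    intro x hx
    rw [sq x hx]
    split_ifs <;> omega
  have desc : ∀ x y, x < y → y < n →
      decInsert n k (decInsert n k y) < decInsert n k (decInsert n k x) →
      y = k ∨ (decInsert n k (decInsert n k x) = n - 1 ∧ (x + 1 = k ∨ k ≤ x)) := by
    intro x y hxy hy
    rw [sq x (by omega), sq y hy]
    split_ifs <;> omega
  refine ⟨?_, ?_, ?_, ?_, ?_⟩
  · intro x hx
    unfold decInsert
    split_ifs <;> omega
  · intro x hx y hy
    unfold decInsert
    split_ifs <;> omega
  · intro x hx
    simp [decInsert, hx]
  · intro a b c hab hbc hc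
    unfold decInsert
    split_ifs <;> omega
  · intro a b c hab hbc hc h1 h2
    have ha := sq_lt a (by omega)
    have hbc' := desc b c hbc hc h1
    have hab' := desc a b hab (by omega) h2
    omega

theorem sum_card_goodFinset_le (n : ℕ) :
    ∑ i ∈ Finset.Icc 1 n, ((i + 1) / 2) * (goodFinset (n - i)).card ≤ (goodFinset n).card := by
  have hcard : ∑ i ∈ Finset.Icc 1 n, ((i + 1) / 2) * (goodFinset (n - i)).card =
      ((Finset.Icc 1 n).sigma
        fun i => Finset.range ((i + 1) / 2) ×ˢ goodFinset (n - i)).card := by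
    simp
  rw [hcard]
  refine Finset.card_le_card_of_injOn
    (fun t => natDirectSum t.1 (decInsert t.1 t.2.1) t.2.2) ?_ ?_
  · rintro ⟨i, k, f⟩ h
    simp only [Finset.mem_coe, Finset.mem_sigma, Finset.mem_Icc, Finset.mem_product,
      Finset.mem_range, mem_goodFinset] at h ⊢
    obtain ⟨⟨_, hi⟩, hk, hf⟩ := h
    simpa only [Nat.add_sub_cancel' hi] using (goodOn_decInsert hk).natDirectSum hf
  · rintro ⟨i, k, f⟩ h ⟨j, l, g⟩ h' heq
    simp only [Finset.mem_coe, Finset.mem_sigma, Finset.mem_Icc, Finset.mem_product,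
      Finset.mem_range, mem_goodFinset] at h h' heq
    obtain ⟨⟨hi1, hi⟩, hk, hf⟩ := h
    obtain ⟨⟨hj1, hj⟩, hl, hg⟩ := h'
    have hgood := (goodOn_decInsert hk).natDirectSum hf
    have hij : i = j := by
      have h0 : natDirectSum i (decInsert i k) f (i - 1) = 0 := by
        rw [natDirectSum_of_lt _ _ (by omega), decInsert_last hi1 hk]
      have h1 : natDirectSum i (decInsert i k) f (j - 1) = 0 := by
        rw [heq, natDirectSum_of_lt _ _ (by omega), decInsert_last hj1 hl]
      have := hgood.inj (i - 1) (by omega) (j - 1) (by omega) (h0.trans h1.symm)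
      omega
    subst hij
    have hkl : k = l := by
      have h0 : natDirectSum i (decInsert i k) f k = i - 1 := by
        rw [natDirectSum_of_lt _ _ (by omega), decInsert_self (by omega)]
      have h1 : natDirectSum i (decInsert i k) f l = i - 1 := by
        rw [heq, natDirectSum_of_lt _ _ (by omega), decInsert_self (by omega)]
      exact hgood.inj k (by omega) l (by omega) (h0.trans h1.symm)
    subst hkl
    have hfg : f = g := by
      funext x
      have := congrFun heq (i + x)
      simpa only [natDirectSum_add, Nat.add_right_cancel_iff] using this
    rw [hfg]

theorem le_card_goodFinset (d : ℕ → ℕ) (hd0 : d 0 = 1) (hd1 : d 1 = 1)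
    (hd : ∀ n : ℕ, 2 ≤ n → d n = ∑ i ∈ Finset.Icc 1 n, ((i + 1) / 2) * d (n - i)) (n : ℕ) :
    d n ≤ (goodFinset n).card := by
  induction n using Nat.strong_induction_on with
  | _ n ih =>
    rcases Nat.eq_zero_or_pos n with rfl | hn
    · rw [hd0, Nat.succ_le_iff, Finset.card_pos]
      refine ⟨id, mem_goodFinset.2 ⟨?_, ?_, ?_, ?_, ?_⟩⟩ <;> simp
    · have hrec : d n = ∑ i ∈ Finset.Icc 1 n, ((i + 1) / 2) * d (n - i) := by
        rcases Nat.lt_or_ge n 2 with h | h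
        · obtain rfl : n = 1 := by omega
          simp [hd0, hd1]
        · exact hd n h
      rw [hrec]
      refine (Finset.sum_le_sum fun i hi => ?_).trans (sum_card_goodFinset_le n)
      rw [Finset.mem_Icc] at hi
      exact Nat.mul_le_mul_left _ (ih (n - i) (by omega))

theorem stmt13 (d : ℕ → ℕ) (hd0 : d 0 = 1) (hd1 : d 1 = 1)
    (hd : ∀ n : ℕ, 2 ≤ n → d n = ∑ i ∈ Finset.Icc 1 n, ((i + 1) / 2) * d (n - i))
    (n : ℕ) (hn : 1 ≤ n) :
    d n ≤ Nat.card {π : Equiv.Perm (Fin n) //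
      PermAvoids π p312 ∧ PermAvoids (π ^ 2) p321} := by
  exact (le_card_goodFinset d hd0 hd1 hd n).trans (card_goodFinset_le n)
end

section
/- Fix an integer k ≥ 2, let D(k) be the set of positive integers d such that d divides k or d divides k−1, and for n ≥ 0 let c_n^{(k)} denote the number of permutations π ∈ S_n such that π avoids both of the patterns 231 and 321 and π^k avoids the pattern 231 (with c_0^{(k)} = 1 counting the empty permutation). Then c_1^{(k)} = 1 and, for every n ≥ 2, c_n^{(k)} = Σ_{d ∈ D(k)} c_{n−d}^{(k)}, with the convention that c_i^{(k)} = 0 for i < 0. -/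
theorem permContains_p231_iff {n : ℕ} (π : Equiv.Perm (Fin n)) :
    PermContains π p231 ↔ ∃ i j l, i < j ∧ j < l ∧ π l < π i ∧ π i < π j := by
  constructor
  · rintro ⟨f, hf, h⟩
    exact ⟨f 0, f 1, f 2, hf (by decide), hf (by decide), (h 2 0).1 (by decide),
      (h 0 1).1 (by decide)⟩
  · rintro ⟨i, j, l, hij, hjl, hli, hij'⟩
    refine ⟨![i, j, l], Fin.strictMono_iff_lt_succ.2 fun a => ?_, fun a b => ?_⟩
    · fin_cases a <;> simpa
    · fin_cases a <;> fin_cases b <;> simp [p231] <;> order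

theorem permContains_p321_iff {n : ℕ} (π : Equiv.Perm (Fin n)) :
    PermContains π p321 ↔ ∃ i j l, i < j ∧ j < l ∧ π l < π j ∧ π j < π i := by
  constructor
  · rintro ⟨f, hf, h⟩
    exact ⟨f 0, f 1, f 2, hf (by decide), hf (by decide), (h 2 1).1 (by decide),
      (h 1 0).1 (by decide)⟩
  · rintro ⟨i, j, l, hij, hjl, hli, hij'⟩
    refine ⟨![i, j, l], Fin.strictMono_iff_lt_succ.2 fun a => ?_, fun a b => ?_⟩
    · fin_cases a <;> simpa
    · fin_cases a <;> fin_cases b <;> simp [p321] <;> order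

/-- The direct sum of two permutations. -/
def permDirectSum (a b : ℕ) (p : Equiv.Perm (Fin a) × Equiv.Perm (Fin b)) :
    Equiv.Perm (Fin (a + b)) :=
  finSumFinEquiv.permCongr (Equiv.Perm.sumCongr p.1 p.2)

@[simp]
theorem permDirectSum_castAdd {a b : ℕ} (p : Equiv.Perm (Fin a) × Equiv.Perm (Fin b)) (i : Fin a) :
    permDirectSum a b p (Fin.castAdd b i) = Fin.castAdd b (p.1 i) := by
  simp [permDirectSum, Equiv.permCongr_apply]

@[simp]
theorem permDirectSum_natAdd {a b : ℕ} (p : Equiv.Perm (Fin a) × Equiv.Perm (Fin b)) (i : Fin b) :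
    permDirectSum a b p (Fin.natAdd a i) = Fin.natAdd a (p.2 i) := by
  simp [permDirectSum, Equiv.permCongr_apply]

theorem permDirectSum_pow {a b : ℕ} (p : Equiv.Perm (Fin a) × Equiv.Perm (Fin b)) (k : ℕ) :
    permDirectSum a b p ^ k = permDirectSum a b (p ^ k) := by
  induction k with
  | zero =>
    ext x
    refine Fin.addCases (fun i => ?_) (fun i => ?_) x <;> simp
  | succ k ih =>
    rw [pow_succ, ih, pow_succ]
    ext x
    refine Fin.addCases (fun i => ?_) (fun i => ?_) x <;> simp

theorem permDirectSum_injective (a b : ℕ) : Function.Injective (permDirectSum a b) := by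
  rintro p q h
  refine Prod.ext (Equiv.ext fun i => ?_) (Equiv.ext fun i => ?_)
  · have := congrArg (fun σ => σ (Fin.castAdd b i)) h
    simpa using this
  · have := congrArg (fun σ => σ (Fin.natAdd a i)) h
    simpa using this

theorem exists_permDirectSum_eq {a b : ℕ} (π : Equiv.Perm (Fin (a + b)))
    (h : ∀ i : Fin (a + b), i.val < a → (π i).val < a) : ∃ p, permDirectSum a b p = π := by
  have hm : Set.MapsTo (finSumFinEquiv.symm.permCongr π) (Set.range Sum.inl)
      (Set.range Sum.inl) := by
    rintro _ ⟨i, rfl⟩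
    refine ⟨⟨π (Fin.castAdd b i), h _ i.isLt⟩, ?_⟩
    rw [Equiv.permCongr_apply, ← finSumFinEquiv.apply_eq_iff_eq]
    ext
    simp
  obtain ⟨p, hp⟩ := Equiv.Perm.mem_sumCongrHom_range_of_perm_mapsTo_inl hm
  refine ⟨p, ?_⟩
  rw [Equiv.Perm.sumCongrHom_apply] at hp
  rw [permDirectSum, hp]
  ext
  simp

theorem permAvoids_p231_permDirectSum {a b : ℕ} (p : Equiv.Perm (Fin a) × Equiv.Perm (Fin b)) :
    PermAvoids (permDirectSum a b p) p231 ↔ PermAvoids p.1 p231 ∧ PermAvoids p.2 p231 := by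
  simp only [PermAvoids, permContains_p231_iff, ← not_or, not_iff_not]
  constructor
  · rintro ⟨i, j, l, h1, h2, h3, h4⟩
    induction i using Fin.addCases <;> induction j using Fin.addCases <;>
      induction l using Fin.addCases <;>
      simp only [Fin.lt_def, permDirectSum_castAdd, permDirectSum_natAdd, Fin.val_castAdd,
        Fin.val_natAdd, Nat.add_lt_add_iff_left] at h1 h2 h3 h4 <;> first
      | omega
      | exact Or.inl ⟨_, _, _, h1, h2, h3, h4⟩
      | exact Or.inr ⟨_, _, _, h1, h2, h3, h4⟩
  · rintro (⟨i, j, l, h1, h2, h3, h4⟩ | ⟨i, j, l, h1, h2, h3, h4⟩)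
    · exact ⟨i.castAdd b, j.castAdd b, l.castAdd b, h1, h2,
        by rw [permDirectSum_castAdd, permDirectSum_castAdd]; exact h3,
        by rw [permDirectSum_castAdd, permDirectSum_castAdd]; exact h4⟩
    · exact ⟨i.natAdd a, j.natAdd a, l.natAdd a, by simpa using ⟨h1, h2, h3, h4⟩⟩

theorem permAvoids_p321_permDirectSum {a b : ℕ} (p : Equiv.Perm (Fin a) × Equiv.Perm (Fin b)) :
    PermAvoids (permDirectSum a b p) p321 ↔ PermAvoids p.1 p321 ∧ PermAvoids p.2 p321 := by
  simp only [PermAvoids, permContains_p321_iff, ← not_or, not_iff_not]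
  constructor
  · rintro ⟨i, j, l, h1, h2, h3, h4⟩
    induction i using Fin.addCases <;> induction j using Fin.addCases <;>
      induction l using Fin.addCases <;>
      simp only [Fin.lt_def, permDirectSum_castAdd, permDirectSum_natAdd, Fin.val_castAdd,
        Fin.val_natAdd, Nat.add_lt_add_iff_left] at h1 h2 h3 h4 <;> first
      | omega
      | exact Or.inl ⟨_, _, _, h1, h2, h3, h4⟩
      | exact Or.inr ⟨_, _, _, h1, h2, h3, h4⟩
  · rintro (⟨i, j, l, h1, h2, h3, h4⟩ | ⟨i, j, l, h1, h2, h3, h4⟩)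
    · exact ⟨i.castAdd b, j.castAdd b, l.castAdd b, h1, h2,
        by rw [permDirectSum_castAdd, permDirectSum_castAdd]; exact h3,
        by rw [permDirectSum_castAdd, permDirectSum_castAdd]; exact h4⟩
    · exact ⟨i.natAdd a, j.natAdd a, l.natAdd a, by simpa using ⟨h1, h2, h3, h4⟩⟩

/-- The cyclic shift with one-line notation `d 1 2 ⋯ (d - 1)`, where `d = e + 1`. -/
def backShift (e : ℕ) : Equiv.Perm (Fin (e + 1)) := Equiv.subRight 1

theorem backShift_pow_apply (e k : ℕ) (i : Fin (e + 1)) :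
    (backShift e ^ k) i = i - Fin.ofNat (e + 1) k := by
  induction k with
  | zero => simp
  | succ k ih =>
    rw [pow_succ', Equiv.Perm.mul_apply, ih, backShift, Equiv.subRight_apply, sub_sub]
    congr 1
    ext
    simp [Fin.val_add]

theorem val_backShift_pow_apply (e k : ℕ) (i : Fin (e + 1)) :
    ((backShift e ^ k) i).val = if k % (e + 1) ≤ i.val then i.val - k % (e + 1)
      else i.val + (e + 1) - k % (e + 1) := by
  rw [backShift_pow_apply]
  split_ifs with h
  · rw [Fin.coe_sub_iff_le.2 (by simpa [Fin.le_def] using h), Fin.val_ofNat]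
  · rw [Fin.coe_sub_iff_lt.2 (by simpa [Fin.lt_def] using h), Fin.val_ofNat, Nat.add_comm (e + 1)]

theorem permAvoids_p231_backShift_pow (e k : ℕ) :
    PermAvoids (backShift e ^ k) p231 ↔ k % (e + 1) ≤ 1 := by
  have hr : k % (e + 1) < e + 1 := Nat.mod_lt k e.succ_pos
  simp only [PermAvoids, permContains_p231_iff, Fin.lt_def, val_backShift_pow_apply]
  constructor
  · intro h
    by_contra! h1
    refine h ⟨⟨0, by omega⟩, ⟨1, by omega⟩, ⟨k % (e + 1), hr⟩, by simp, h1, ?_, ?_⟩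
    · simp only [le_refl, if_true]
      split_ifs <;> omega
    · dsimp only
      split_ifs <;> omega
  · rintro h ⟨i, j, l, h1, h2, h3, h4⟩
    split_ifs at h3 h4 <;> omega

theorem val_backShift_apply (e : ℕ) (i : Fin (e + 1)) :
    (backShift e i).val = if i.val = 0 then e else i.val - 1 := by
  have h := val_backShift_pow_apply e 1 i
  rw [pow_one] at h
  rw [h]
  rcases e with _ | e
  · simp
  · rw [Nat.one_mod_eq_one.2 (by omega)]
    split_ifs <;> omega

theorem permAvoids_p231_backShift (e : ℕ) : PermAvoids (backShift e) p231 := by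
  simpa using (permAvoids_p231_backShift_pow e 1).2 (Nat.mod_le _ _)

theorem permAvoids_p321_backShift (e : ℕ) : PermAvoids (backShift e) p321 := by
  simp only [PermAvoids, permContains_p321_iff, Fin.lt_def, val_backShift_apply]
  rintro ⟨i, j, l, h1, h2, h3, h4⟩
  split_ifs at h3 h4 <;> omega

theorem apply_eq_pred_of_permAvoids {n : ℕ} (hn : 0 < n) (π : Equiv.Perm (Fin n))
    (h231 : PermAvoids π p231) (h321 : PermAvoids π p321) (v : ℕ) (hv : v < (π ⟨0, hn⟩).val) :
    ∃ h : v + 1 < n, (π ⟨v + 1, h⟩).val = v := by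
  simp only [PermAvoids, permContains_p231_iff, permContains_p321_iff] at h231 h321
  induction v using Nat.strong_induction_on with
  | _ v ih =>
    have hvn : v + 1 < n := lt_of_le_of_lt hv (π ⟨0, hn⟩).isLt
    refine ⟨hvn, ?_⟩
    obtain ⟨j, hj⟩ := π.surjective ⟨v, by omega⟩
    have hj0 : j.val ≠ 0 := by
      intro h
      rw [show j = ⟨0, hn⟩ from Fin.ext h] at hj
      simp [hj] at hv
    have hjv : v < j.val := by
      by_contra! hle
      obtain ⟨_, h⟩ := ih (j.val - 1) (by omega) (by omega)
      rw [show (⟨j.val - 1 + 1, _⟩ : Fin n) = j from Fin.ext (Nat.sub_add_cancel (by omega)),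
        hj] at h
      simp only at h
      omega
    rcases Nat.eq_or_lt_of_le hjv with h | h
    · rw [show (⟨v + 1, hvn⟩ : Fin n) = j from Fin.ext h, hj]
    · exfalso
      set i : Fin n := ⟨v + 1, hvn⟩ with hi
      have hij : i < j := h
      have h0i : (⟨0, hn⟩ : Fin n) < i := Fin.lt_def.2 (Nat.succ_pos v)
      have hj0' : π j < π ⟨0, hn⟩ := by rw [hj]; exact hv
      rcases lt_or_ge (π i) (π j) with hlt | hge
      · have hlt' : (π i).val < v := by rw [hj] at hlt; exact hlt
        obtain ⟨_, h'⟩ := ih (π i).val hlt' (by omega)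
        have := congrArg Fin.val (π.injective (Fin.ext h'))
        simp only [hi] at this hlt'
        omega
      · have hji : π j < π i := lt_of_le_of_ne hge fun h => hij.ne' (π.injective h)
        rcases lt_trichotomy (π ⟨0, hn⟩) (π i) with hlt | heq | hgt
        · exact h231 ⟨_, i, j, h0i, hij, hj0', hlt⟩
        · exact h0i.ne (π.injective heq)
        · exact h321 ⟨_, i, j, h0i, hij, hji, hgt⟩

theorem exists_permDirectSum_backShift_eq {e m : ℕ} (π : Equiv.Perm (Fin (e + 1 + m)))
    (h231 : PermAvoids π p231) (h321 : PermAvoids π p321)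
    (h0 : (π ⟨0, by omega⟩).val = e) :
    ∃ σ : Equiv.Perm (Fin m), permDirectSum (e + 1) m (backShift e, σ) = π := by
  have key : ∀ i : Fin (e + 1 + m), i.val < e + 1 →
      (π i).val = if i.val = 0 then e else i.val - 1 := by
    intro i hi
    split_ifs with h
    · rwa [show i = ⟨0, by omega⟩ from Fin.ext h]
    · obtain ⟨_, h'⟩ := apply_eq_pred_of_permAvoids (by omega) π h231 h321 (i.val - 1) (by omega)
      rwa [show (⟨i.val - 1 + 1, _⟩ : Fin (e + 1 + m)) = i from
        Fin.ext (Nat.sub_add_cancel (by omega))] at h'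
  obtain ⟨⟨ρ, σ⟩, rfl⟩ := exists_permDirectSum_eq π fun i hi => by
    rw [key i hi]
    split_ifs <;> omega
  refine ⟨σ, ?_⟩
  congr
  ext i
  have := key (Fin.castAdd m i) i.isLt
  rw [val_backShift_apply]
  simpa using this.symm

theorem mod_le_one_iff {k d : ℕ} (hk : 2 ≤ k) :
    k % d ≤ 1 ↔ d ∈ Nat.divisors k ∪ Nat.divisors (k - 1) := by
  have h1 : k - 1 ≠ 0 := by omega
  have h2 : k ≠ 0 := by omega
  simp only [Finset.mem_union, Nat.mem_divisors, h1, h2, ne_eq, not_false_eq_true, and_true]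
  constructor
  · intro h
    rcases Nat.le_one_iff_eq_zero_or_eq_one.1 h with h | h
    · exact Or.inl (Nat.dvd_of_mod_eq_zero h)
    · right
      have := Nat.dvd_sub_mod (n := d) k
      rwa [h] at this
  · rintro (h | ⟨c, hc⟩)
    · rw [Nat.mod_eq_zero_of_dvd h]
      omega
    · rw [show k = 1 + d * c by omega, Nat.add_mul_mod_self_left]
      exact Nat.mod_le _ _

/-- The permutations avoiding 231 and 321 whose `k`-th power avoids 231. -/
def PowerAvoids (k : ℕ) {n : ℕ} (π : Equiv.Perm (Fin n)) : Prop :=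
  PermAvoids π p231 ∧ PermAvoids π p321 ∧ PermAvoids (π ^ k) p231

theorem powerAvoids_permDirectSum_backShift_iff {k e m : ℕ} (hk : 2 ≤ k)
    (σ : Equiv.Perm (Fin m)) :
    PowerAvoids k (permDirectSum (e + 1) m (backShift e, σ)) ↔
      e + 1 ∈ Nat.divisors k ∪ Nat.divisors (k - 1) ∧ PowerAvoids k σ := by
  simp only [PowerAvoids, permDirectSum_pow, permAvoids_p231_permDirectSum,
    permAvoids_p321_permDirectSum, permAvoids_p231_backShift, permAvoids_p321_backShift,
    Prod.pow_fst, Prod.pow_snd, permAvoids_p231_backShift_pow, mod_le_one_iff hk]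
  tauto

open Classical in
theorem card_powerAvoids_fiber {k e m : ℕ} (hk : 2 ≤ k)
    (he : e + 1 ∈ Nat.divisors k ∪ Nat.divisors (k - 1)) :
    Finset.card {π : Equiv.Perm (Fin (e + 1 + m)) |
      PowerAvoids k π ∧ (π ⟨0, by omega⟩).val = e} =
    Finset.card {σ : Equiv.Perm (Fin m) | PowerAvoids k σ} := by
  symm
  refine Finset.card_bij (fun σ _ => permDirectSum (e + 1) m (backShift e, σ)) ?_ ?_ ?_
  · intro σ hσ
    simp only [Finset.mem_filter, Finset.mem_univ, true_and] at hσ ⊢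
    refine ⟨(powerAvoids_permDirectSum_backShift_iff hk σ).2 ⟨he, hσ⟩, ?_⟩
    have := permDirectSum_castAdd (b := m) (backShift e, σ) 0
    rw [show (⟨0, _⟩ : Fin (e + 1 + m)) = Fin.castAdd m 0 from rfl, this]
    simp [val_backShift_apply]
  · intro σ _ τ _ h
    exact (Prod.ext_iff.1 (permDirectSum_injective _ _ h)).2
  · intro π hπ
    simp only [Finset.mem_filter, Finset.mem_univ, true_and] at hπ
    obtain ⟨σ, rfl⟩ := exists_permDirectSum_backShift_eq π hπ.1.1 hπ.1.2.1 hπ.2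
    exact ⟨σ, by simpa using ((powerAvoids_permDirectSum_backShift_iff hk σ).1 hπ.1).2, rfl⟩

open Classical in
theorem card_powerAvoids_eq_sum {k n : ℕ} (hk : 2 ≤ k) (hn : 0 < n) :
    Finset.card {π : Equiv.Perm (Fin n) | PowerAvoids k π} =
      ∑ d ∈ (Nat.divisors k ∪ Nat.divisors (k - 1)).filter (fun d => d ≤ n),
        Finset.card {σ : Equiv.Perm (Fin (n - d)) | PowerAvoids k σ} := by
  rw [Finset.card_eq_sum_card_fiberwise (f := fun π => (π ⟨0, hn⟩).val + 1)
    (t := (Nat.divisors k ∪ Nat.divisors (k - 1)).filter (fun d => d ≤ n))]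
  · refine Finset.sum_congr rfl fun d hd => ?_
    rw [Finset.mem_filter] at hd
    obtain ⟨e, rfl⟩ : ∃ e, d = e + 1 := Nat.exists_eq_succ_of_ne_zero fun h => by
      subst h
      simp at hd
    obtain ⟨m, rfl⟩ := Nat.exists_eq_add_of_le hd.2
    rw [Nat.add_sub_cancel_left, ← card_powerAvoids_fiber hk hd.1, Finset.filter_filter]
    simp only [Nat.add_right_cancel_iff]
  · intro π hπ
    simp only [Finset.coe_filter, Finset.mem_univ, true_and, Set.mem_ofPred_eq] at hπ ⊢
    have hlt := (π ⟨0, hn⟩).isLt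
    refine ⟨?_, hlt⟩
    generalize he : (π ⟨0, hn⟩).val = e at hlt ⊢
    obtain ⟨m, rfl⟩ := Nat.exists_eq_add_of_le (Nat.succ_le_of_lt hlt)
    obtain ⟨σ, rfl⟩ := exists_permDirectSum_backShift_eq π hπ.1 hπ.2.1 he
    exact ((powerAvoids_permDirectSum_backShift_iff hk σ).1 hπ).1

theorem stmt17 (k : ℕ) (hk : 2 ≤ k) (c : ℕ → ℕ)
    (hc : ∀ n : ℕ, c n = Nat.card {π : Equiv.Perm (Fin n) //
      PermAvoids π p231 ∧ PermAvoids π p321 ∧ PermAvoids (π ^ k) p231}) :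
    c 1 = 1 ∧ ∀ n : ℕ, 2 ≤ n →
      c n = ∑ d ∈ (Nat.divisors k ∪ Nat.divisors (k - 1)).filter (fun d => d ≤ n),
        c (n - d) := by
  classical
  have hc' : ∀ n, c n = Finset.card {π : Equiv.Perm (Fin n) | PowerAvoids k π} := fun n => by
    rw [hc, Nat.card_eq_fintype_card, Fintype.card_subtype]
    congr!
  refine ⟨?_, fun n hn => ?_⟩
  · rw [hc' 1, Finset.card_eq_one]
    refine ⟨1, Finset.ext fun π => ?_⟩
    have : PowerAvoids k π := by
      simp only [PowerAvoids, PermAvoids, permContains_p231_iff, permContains_p321_iff]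
      refine ⟨?_, ?_, ?_⟩ <;> rintro ⟨i, j, l, h, -⟩ <;> omega
    simpa [Subsingleton.elim π 1] using this
  · simp only [hc']
    exact card_powerAvoids_eq_sum hk (by omega)
end

section
/- Fix an integer k ≥ 2, let D'(k) be the set of positive integers d such that d divides k or d divides k+1, and for n ≥ 0 let c_n^{(k)} denote the number of permutations π ∈ S_n such that π avoids both of the patterns 231 and 321 and π^k avoids the pattern 312 (with c_0^{(k)} = 1 counting the empty permutation). Then c_1^{(k)} = 1 and, for every n ≥ 2, c_n^{(k)} = Σ_{d ∈ D'(k)} c_{n−d}^{(k)}, with the convention that c_i^{(k)} = 0 for i < 0. -/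
/-- The direct sum `α ⊕ σ` of two permutations. -/
def permSum {a b : ℕ} (α : Equiv.Perm (Fin a)) (σ : Equiv.Perm (Fin b)) :
    Equiv.Perm (Fin (a + b)) :=
  finSumFinEquiv.permCongrHom (Equiv.Perm.sumCongrHom _ _ (α, σ))

/-- The rotation `d, 0, 1, …, d - 1` of `Fin (d + 1)`. -/
def rotPerm (d : ℕ) : Equiv.Perm (Fin (d + 1)) := (finRotate (d + 1))⁻¹

lemma permSum_castAdd {a b : ℕ} (α : Equiv.Perm (Fin a)) (σ : Equiv.Perm (Fin b)) (i : Fin a) :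
    permSum α σ (Fin.castAdd b i) = Fin.castAdd b (α i) := by
  simp [permSum, Equiv.permCongrHom, Equiv.permCongr_apply]

lemma permSum_natAdd {a b : ℕ} (α : Equiv.Perm (Fin a)) (σ : Equiv.Perm (Fin b)) (j : Fin b) :
    permSum α σ (Fin.natAdd a j) = Fin.natAdd a (σ j) := by
  simp [permSum, Equiv.permCongrHom, Equiv.permCongr_apply]

lemma permSum_pow {a b : ℕ} (α : Equiv.Perm (Fin a)) (σ : Equiv.Perm (Fin b)) (k : ℕ) :
    permSum α σ ^ k = permSum (α ^ k) (σ ^ k) := by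
  simp only [permSum, ← map_pow, Prod.pow_mk]

lemma permSum_right_injective {a b : ℕ} (α : Equiv.Perm (Fin a)) :
    Function.Injective (permSum α : Equiv.Perm (Fin b) → Equiv.Perm (Fin (a + b))) := by
  intro σ τ h
  ext j
  have := congrArg (fun π => (π (Fin.natAdd a j)).val) h
  simpa [permSum_natAdd] using this

lemma finRotate_pow_val (d k : ℕ) (i : Fin (d + 1)) :
    ((finRotate (d + 1) ^ k) i).val = (i.val + k) % (d + 1) := by
  induction k with
  | zero => simp [Nat.mod_eq_of_lt i.isLt]
  | succ k ih =>
    rw [pow_succ', Equiv.Perm.mul_apply, finRotate_apply, Fin.val_add, ih, Fin.coe_ofNat_eq_mod,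
      ← Nat.add_mod, add_assoc]

lemma rotPerm_pow_val (d k : ℕ) (i : Fin (d + 1)) :
    (((rotPerm d ^ k) i).val + k) % (d + 1) = i.val := by
  rw [← finRotate_pow_val, rotPerm, inv_pow]
  simp

lemma rotPerm_zero (d : ℕ) : (rotPerm d 0).val = d := by
  have h := rotPerm_pow_val d 1 0
  have h2 := (rotPerm d 0).isLt
  rw [pow_one] at h
  by_contra hne
  rw [Nat.mod_eq_of_lt (by omega)] at h
  simp at h

lemma rotPerm_pos (d : ℕ) (i : Fin (d + 1)) (hi : 0 < i.val) : (rotPerm d i).val + 1 = i.val := by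
  have h := rotPerm_pow_val d 1 i
  have h2 := (rotPerm d i).isLt
  rw [pow_one] at h
  rcases Nat.lt_or_ge ((rotPerm d i).val + 1) (d + 1) with h3 | h3
  · rwa [Nat.mod_eq_of_lt h3] at h
  · have : (rotPerm d i).val + 1 = d + 1 := by omega
    rw [this, Nat.mod_self] at h
    omega

/-- Every entry is preceded by at most one larger entry. -/
def AtMostOneLargerBefore {n : ℕ} (π : Equiv.Perm (Fin n)) : Prop :=
  ∀ x y z : Fin n, x < y → y < z → π z < π x → π y < π z

lemma permContains_of_lt {n : ℕ} {π : Equiv.Perm (Fin n)} {τ : Equiv.Perm (Fin 3)}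
    {x y z : Fin n} (hxy : x < y) (hyz : y < z)
    (h01 : τ 0 < τ 1 ↔ π x < π y) (h02 : τ 0 < τ 2 ↔ π x < π z)
    (h12 : τ 1 < τ 2 ↔ π y < π z) : PermContains π τ := by
  have ne {a b : Fin n} (h : a < b) : π a ≠ π b := fun e => h.ne (π.injective e)
  have ne3 {a b : Fin 3} (h : a < b) : τ a ≠ τ b := fun e => h.ne (τ.injective e)
  have swap {a b : Fin 3} {u v : Fin n} (h : a < b) (huv : u < v)
      (hi : τ a < τ b ↔ π u < π v) : τ b < τ a ↔ π v < π u := by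
    have h1 := ne3 h
    have h2 := ne huv
    rw [← not_le, ← not_le, not_iff_not, h1.le_iff_lt, h2.le_iff_lt, hi]
  have h10 := swap (by decide) hxy h01
  have h20 := swap (by decide) (hxy.trans hyz) h02
  have h21 := swap (by decide) hyz h12
  refine ⟨![x, y, z], ?_, ?_⟩
  · intro i j hij
    fin_cases i <;> fin_cases j <;> simp_all [hxy.trans hyz]
  · intro i j
    fin_cases i <;> fin_cases j <;> simp_all

lemma avoids_231_321_iff {n : ℕ} (π : Equiv.Perm (Fin n)) :
    PermAvoids π p231 ∧ PermAvoids π p321 ↔ AtMostOneLargerBefore π := by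
  constructor
  · rintro ⟨h1, h2⟩ x y z hxy hyz hzx
    by_contra hyz'
    have hne : π y ≠ π z := fun e => hyz.ne (π.injective e)
    have hne' : π x ≠ π y := fun e => hxy.ne (π.injective e)
    have hzy : π z < π y := lt_of_le_of_ne (not_lt.mp hyz') hne.symm
    rcases lt_or_gt_of_ne hne' with h | h
    · exact h1 (permContains_of_lt hxy hyz (iff_of_true (by decide) h)
        (iff_of_false (by decide) hzx.not_gt) (iff_of_false (by decide) hyz'))
    · exact h2 (permContains_of_lt hxy hyz (iff_of_false (by decide) h.not_gt)
        (iff_of_false (by decide) hzx.not_gt) (iff_of_false (by decide) hyz'))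
  · intro h
    constructor <;> rintro ⟨f, hf, hp⟩
    · exact ((hp 1 2).not.mp (by decide)) (h (f 0) (f 1) (f 2) (hf (by decide)) (hf (by decide))
        ((hp 2 0).mp (by decide)))
    · exact ((hp 1 2).not.mp (by decide)) (h (f 0) (f 1) (f 2) (hf (by decide)) (hf (by decide))
        ((hp 2 0).mp (by decide)))

lemma avoids_312_iff {n : ℕ} (π : Equiv.Perm (Fin n)) :
    PermAvoids π p312 ↔ ∀ x y z : Fin n, x < y → y < z → π y < π z → π x < π z := by
  constructor
  · intro h x y z hxy hyz hp
    by_contra hxz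
    have hne : π x ≠ π z := fun e => (hxy.trans hyz).ne (π.injective e)
    have hzx : π z < π x := lt_of_le_of_ne (not_lt.mp hxz) hne.symm
    exact h (permContains_of_lt hxy hyz (iff_of_false (by decide) (hp.trans hzx).not_gt)
      (iff_of_false (by decide) hxz) (iff_of_true (by decide) hp))
  · rintro h ⟨f, hf, hp⟩
    exact ((hp 0 2).not.mp (by decide)) (h (f 0) (f 1) (f 2) (hf (by decide)) (hf (by decide))
      ((hp 1 2).mp (by decide)))

lemma forall_fin_add {a b : ℕ} {P : Fin (a + b) → Prop} :
    (∀ x, P x) ↔ (∀ i, P (Fin.castAdd b i)) ∧ ∀ j, P (Fin.natAdd a j) :=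
  ⟨fun h => ⟨fun _ => h _, fun _ => h _⟩, fun h x => Fin.addCases h.1 h.2 x⟩

lemma atMostOneLargerBefore_permSum {a b : ℕ} (α : Equiv.Perm (Fin a)) (σ : Equiv.Perm (Fin b)) :
    AtMostOneLargerBefore (permSum α σ) ↔ AtMostOneLargerBefore α ∧ AtMostOneLargerBefore σ := by
  simp only [AtMostOneLargerBefore]
  constructor
  · intro h
    constructor
    · intro x y z
      simpa only [permSum_castAdd, Fin.lt_def, Fin.val_castAdd, add_lt_add_iff_left] using
        h (Fin.castAdd b x) (Fin.castAdd b y) (Fin.castAdd b z)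
    · intro x y z
      simpa only [permSum_natAdd, Fin.lt_def, Fin.val_natAdd, add_lt_add_iff_left] using
        h (Fin.natAdd a x) (Fin.natAdd a y) (Fin.natAdd a z)
  · rintro ⟨h1, h2⟩
    simp only [Fin.lt_def] at h1 h2
    refine forall_fin_add.mpr ⟨fun x => ?_, fun x => ?_⟩ <;>
    refine forall_fin_add.mpr ⟨fun y => ?_, fun y => ?_⟩ <;>
    refine forall_fin_add.mpr ⟨fun z => ?_, fun z => ?_⟩ <;>
    simp only [permSum_castAdd, permSum_natAdd, Fin.lt_def, Fin.val_castAdd, Fin.val_natAdd] <;>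
    grind

lemma avoids_312_permSum {a b : ℕ} (α : Equiv.Perm (Fin a)) (σ : Equiv.Perm (Fin b)) :
    PermAvoids (permSum α σ) p312 ↔ PermAvoids α p312 ∧ PermAvoids σ p312 := by
  simp only [avoids_312_iff]
  constructor
  · intro h
    constructor
    · intro x y z
      simpa only [permSum_castAdd, Fin.lt_def, Fin.val_castAdd, add_lt_add_iff_left] using
        h (Fin.castAdd b x) (Fin.castAdd b y) (Fin.castAdd b z)
    · intro x y z
      simpa only [permSum_natAdd, Fin.lt_def, Fin.val_natAdd, add_lt_add_iff_left] using
        h (Fin.natAdd a x) (Fin.natAdd a y) (Fin.natAdd a z)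
  · rintro ⟨h1, h2⟩
    simp only [Fin.lt_def] at h1 h2
    refine forall_fin_add.mpr ⟨fun x => ?_, fun x => ?_⟩ <;>
    refine forall_fin_add.mpr ⟨fun y => ?_, fun y => ?_⟩ <;>
    refine forall_fin_add.mpr ⟨fun z => ?_, fun z => ?_⟩ <;>
    simp only [permSum_castAdd, permSum_natAdd, Fin.lt_def, Fin.val_castAdd, Fin.val_natAdd] <;>
    grind

lemma atMostOneLargerBefore_rotPerm (d : ℕ) : AtMostOneLargerBefore (rotPerm d) := by
  intro x y z hxy hyz _
  have hy := rotPerm_pos d y (by omega)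
  have hz := rotPerm_pos d z (by omega)
  omega

lemma rotPerm_pow_val_eq (d k : ℕ) (i : Fin (d + 1)) :
    ((rotPerm d ^ k) i).val =
      if k % (d + 1) ≤ i.val then i.val - k % (d + 1) else d + 1 + i.val - k % (d + 1) := by
  have h := rotPerm_pow_val d k i
  have h2 := ((rotPerm d ^ k) i).isLt
  have h3 := Nat.mod_lt k d.succ_pos
  rw [← Nat.add_mod_mod, Nat.mod_eq_iff] at h
  simp only [Nat.succ_eq_add_one] at *
  set r := k % (d + 1)
  set v := ((rotPerm d ^ k) i).val
  rcases h with h | ⟨h4, c, h5⟩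
  · omega
  · have : c = 0 ∨ c = 1 := by
      by_contra hc
      have : (d + 1) * 2 ≤ (d + 1) * c := Nat.mul_le_mul_left _ (by omega)
      omega
    rcases this with rfl | rfl <;> split_ifs <;> omega

lemma avoids_312_rotPerm_pow (d k : ℕ) :
    PermAvoids (rotPerm d ^ k) p312 ↔ d + 1 ∣ k ∨ d + 1 ∣ k + 1 := by
  have hdvd : d + 1 ∣ k ∨ d + 1 ∣ k + 1 ↔ k % (d + 1) = 0 ∨ k % (d + 1) = d := by
    rw [Nat.dvd_iff_mod_eq_zero, Nat.dvd_iff_mod_eq_zero, Nat.succ_mod_succ_eq_zero_iff]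
  have h3 : k % (d + 1) < d + 1 := Nat.mod_lt k d.succ_pos
  rw [hdvd, avoids_312_iff]
  simp only [Fin.lt_def, rotPerm_pow_val_eq]
  constructor
  · intro h
    by_contra! hr
    have := h ⟨0, by omega⟩ ⟨k % (d + 1), by omega⟩ ⟨k % (d + 1) + 1, by omega⟩
    simp only at this
    split_ifs at this <;> omega
  · intro hr x y z hxy hyz
    split_ifs <;> omega

lemma exists_permSum_of_atMostOneLargerBefore {d m : ℕ} {π : Equiv.Perm (Fin (d + 1 + m))}
    (h : AtMostOneLargerBefore π) (h0 : (π (Fin.castAdd m 0)).val = d) :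
    ∃ σ, π = permSum (rotPerm d) σ := by
  have key : ∀ i : ℕ, ∀ hi : i < d + 1 + m, 0 < i → i ≤ d → (π ⟨i, hi⟩).val + 1 = i := by
    intro i
    induction i using Nat.strong_induction_on with
    | _ i ih =>
      intro hi hpos hid
      obtain ⟨p, hp⟩ := π.surjective ⟨i - 1, by omega⟩
      have hpv : (π p).val = i - 1 := by rw [hp]
      have hp0 : p.val ≠ 0 := by
        intro e
        have : p = Fin.castAdd m 0 := Fin.ext (by simpa using e)
        rw [this] at hpv
        omega
      have hpi : i ≤ p.val := by
        by_contra hlt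
        have := ih p.val (by omega) p.isLt (by omega) (by omega)
        simp only [Fin.eta] at this
        omega
      rcases hpi.eq_or_lt with e | hlt
      · have : p = ⟨i, hi⟩ := Fin.ext e.symm
        rw [this] at hpv
        omega
      · have h1 := h (Fin.castAdd m 0) ⟨i, hi⟩ p (by simp [Fin.lt_def]; omega)
          (by simpa [Fin.lt_def] using hlt) (by rw [Fin.lt_def]; omega)
        rw [Fin.lt_def, hpv] at h1
        have h2 := ih ((π ⟨i, hi⟩).val + 1) (by omega) (by omega) (by omega) (by omega)
        have h3 := π.injective (Fin.ext (Nat.succ.inj h2))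
        have := congrArg Fin.val h3
        simp only at this
        omega
  have hrot : ∀ i, π (Fin.castAdd m i) = Fin.castAdd m (rotPerm d i) := by
    intro i
    apply Fin.ext
    rcases Nat.eq_zero_or_pos i.val with hi | hi
    · obtain rfl : i = 0 := Fin.ext hi
      simp [h0, rotPerm_zero]
    · have h1 := key i.val (by omega) hi (by omega)
      have h2 := rotPerm_pos d i hi
      change (π (Fin.castAdd m i)).val + 1 = i.val at h1
      simp only [Fin.val_castAdd]
      omega
  obtain ⟨⟨α, σ⟩, hασ⟩ := Equiv.Perm.mem_sumCongrHom_range_of_perm_mapsTo_inl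
    (σ := finSumFinEquiv.permCongrHom.symm π) (by
      rintro _ ⟨i, rfl⟩
      refine ⟨rotPerm d i, ?_⟩
      simp [Equiv.permCongrHom, Equiv.permCongr_apply, hrot])
  have hπ : π = permSum α σ := by
    rw [permSum, hασ, MulEquiv.apply_symm_apply]
  refine ⟨σ, ?_⟩
  have : α = rotPerm d := by
    ext i
    have := hrot i
    rw [hπ, permSum_castAdd] at this
    simpa using congrArg Fin.val this
  rw [hπ, this]

/-- `π` avoids 231 and 321, and its `k`-th power avoids 312. -/
abbrev PowAvoids (k : ℕ) {n : ℕ} (π : Equiv.Perm (Fin n)) : Prop :=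
  PermAvoids π p231 ∧ PermAvoids π p321 ∧ PermAvoids (π ^ k) p312

lemma powAvoids_rotPerm_permSum (k d : ℕ) {m : ℕ} (σ : Equiv.Perm (Fin m)) :
    PowAvoids k (permSum (rotPerm d) σ) ↔ (d + 1 ∣ k ∨ d + 1 ∣ k + 1) ∧ PowAvoids k σ := by
  simp only [PowAvoids, ← and_assoc, avoids_231_321_iff, atMostOneLargerBefore_permSum,
    permSum_pow, avoids_312_permSum, avoids_312_rotPerm_pow, atMostOneLargerBefore_rotPerm,
    true_and]
  tauto

lemma card_powAvoids_apply_zero (k d m n : ℕ) (hn : n + 1 = d + 1 + m) :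
    Nat.card {x : {π : Equiv.Perm (Fin (n + 1)) // PowAvoids k π} // (x.1 0).val = d} =
      if d + 1 ∣ k ∨ d + 1 ∣ k + 1 then
        Nat.card {σ : Equiv.Perm (Fin m) // PowAvoids k σ} else 0 := by
  obtain rfl : n = d + m := by omega
  suffices H : ∀ N (hN : N = d + 1 + m) (z : Fin N), z.val = 0 →
      Nat.card {x : {π : Equiv.Perm (Fin N) // PowAvoids k π} // (x.1 z).val = d} =
      if d + 1 ∣ k ∨ d + 1 ∣ k + 1 then
        Nat.card {σ : Equiv.Perm (Fin m) // PowAvoids k σ} else 0 from H _ hn 0 rfl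
  rintro _ rfl z hz
  obtain rfl : z = Fin.castAdd m 0 := Fin.ext hz
  split_ifs with hd
  · symm
    refine Nat.card_congr (Equiv.ofBijective
      (fun σ => ⟨⟨permSum (rotPerm d) σ.1, (powAvoids_rotPerm_permSum k d _).mpr ⟨hd, σ.2⟩⟩, ?_⟩)
      ⟨?_, ?_⟩)
    · simp only [permSum_castAdd, Fin.val_castAdd, rotPerm_zero]
    · intro σ τ h
      exact Subtype.ext (permSum_right_injective _ (congrArg (fun x => x.1.1) h))
    · rintro ⟨⟨π, hπ⟩, h0⟩
      obtain ⟨σ, rfl⟩ := exists_permSum_of_atMostOneLargerBefore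
        ((avoids_231_321_iff π).mp ⟨hπ.1, hπ.2.1⟩) h0
      exact ⟨⟨σ, ((powAvoids_rotPerm_permSum k d σ).mp hπ).2⟩, rfl⟩
  · rw [Nat.card_eq_zero]
    refine Or.inl ⟨?_⟩
    rintro ⟨⟨π, hπ⟩, h0⟩
    obtain ⟨σ, rfl⟩ := exists_permSum_of_atMostOneLargerBefore
      ((avoids_231_321_iff π).mp ⟨hπ.1, hπ.2.1⟩) h0
    exact hd ((powAvoids_rotPerm_permSum k d σ).mp hπ).1

lemma card_powAvoids_succ (k n : ℕ) :
    Nat.card {π : Equiv.Perm (Fin (n + 1)) // PowAvoids k π} =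
      ∑ d ∈ Finset.range (n + 1), if d + 1 ∣ k ∨ d + 1 ∣ k + 1 then
        Nat.card {σ : Equiv.Perm (Fin (n - d)) // PowAvoids k σ} else 0 := by
  rw [← Nat.card_congr (Equiv.sigmaFiberEquiv
    fun x : {π : Equiv.Perm (Fin (n + 1)) // PowAvoids k π} => x.1 0), Nat.card_sigma,
    Finset.sum_range]
  refine Finset.sum_congr rfl fun v _ => ?_
  rw [← card_powAvoids_apply_zero k v (n - v) n (by omega)]
  simp only [Fin.ext_iff]

lemma powAvoids_of_lt_three (k : ℕ) {n : ℕ} (hn : n < 3) (π : Equiv.Perm (Fin n)) :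
    PowAvoids k π := by
  have h (σ : Equiv.Perm (Fin n)) (τ : Equiv.Perm (Fin 3)) : PermAvoids σ τ := by
    rintro ⟨f, hf, -⟩
    have := Fintype.card_le_of_injective f hf.injective
    simp only [Fintype.card_fin] at this
    omega
  exact ⟨h _ _, h _ _, h _ _⟩

theorem stmt18 (k : ℕ) (hk : 2 ≤ k) (c : ℕ → ℕ)
    (hc : ∀ n : ℕ, c n = Nat.card {π : Equiv.Perm (Fin n) //
      PermAvoids π p231 ∧ PermAvoids π p321 ∧ PermAvoids (π ^ k) p312}) :
    c 1 = 1 ∧ ∀ n : ℕ, 2 ≤ n →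
      c n = ∑ d ∈ (Nat.divisors k ∪ Nat.divisors (k + 1)).filter (fun d => d ≤ n),
        c (n - d) := by
  constructor
  · rw [hc, Nat.card_congr (Equiv.subtypeUnivEquiv (powAvoids_of_lt_three k (by omega)))]
    simp
  · intro n hn
    obtain ⟨n, rfl⟩ : ∃ m, n = m + 1 := ⟨n - 1, by omega⟩
    rw [hc, card_powAvoids_succ, ← Finset.sum_filter]
    simp only [← hc]
    refine Finset.sum_bij (fun d _ => d + 1) ?_ ?_ ?_ ?_
    · intro d hd
      simp only [Finset.mem_filter, Finset.mem_range, Finset.mem_union, Nat.mem_divisors] at hd ⊢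
      omega
    · intro a _ b _ h
      omega
    · intro d hd
      simp only [Finset.mem_filter, Finset.mem_union, Nat.mem_divisors] at hd
      have hpos : 0 < d := by
        rcases hd.1 with h | h <;> exact Nat.pos_of_dvd_of_pos h.1 (by omega)
      refine ⟨d - 1, ?_, by omega⟩
      simp only [Finset.mem_filter, Finset.mem_range, Nat.sub_add_cancel hpos]
      exact ⟨by omega, by tauto⟩
    · intro d _
      rw [Nat.add_sub_add_right]
end
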